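/- arXiv:2512.24736 — 3 statements merged into one kernel-verified Lean document; each statement's English description precedes it below -/
import Mathlib

section
/- Suppose that sup_{t∈T} E[l(ξ−t)²] < +∞, where T is a compact interval, ξ is a real-valued random variable, and l is a proper closed convex nondecreasing loss function. Let v* and S be the optimal value and set of optimal solutions of the problem minimize_{t∈T} t + E[l(ξ−t)], and let v_n and S_n be the optimal value and set of optimal solutions of the sample average approximation minimize_{t∈T} t + (1/n)∑_{i=1}^n l(ξ_i−t) built from i.i.d. observations ξ_1,…,ξ_n of ξ. Then v_n → v* with probability 1, and the deviation D(S_n,S) = sup_{x∈S_n} inf_{y∈S} |x−y| converges to 0 with probability 1. If moreover S is a singleton {t*}, then any t_n ∈ S_n satisfies t_n → t* with probability 1. -/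
open MeasureTheory ProbabilityTheory Filter Set

/-- Antitone functions on `ℝ` that converge at every rational to a continuous function
converge locally uniformly. -/
lemma tendstoLocallyUniformly_of_antitone_of_tendsto_rat {ι : Type*} {p : Filter ι}
    {h : ι → ℝ → ℝ} {H : ℝ → ℝ} (hanti : ∀ n, Antitone (h n)) (hH : Continuous H)
    (hlim : ∀ q : ℚ, Tendsto (fun n => h n q) p (nhds (H q))) :
    TendstoLocallyUniformly h H p := by
  rw [Metric.tendstoLocallyUniformly_iff]
  intro ε hε t
  obtain ⟨δ, hδ, hHδ⟩ := Metric.continuous_iff.1 hH t (ε / 3) (by positivity)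
  obtain ⟨q, hq, hqt⟩ := exists_rat_btwn (show t - δ < t by linarith)
  obtain ⟨r, htr, hr⟩ := exists_rat_btwn (show t < t + δ by linarith)
  have hnear : ∀ s ∈ Icc (q : ℝ) r, |H s - H t| < ε / 3 := fun s hs => by
    have hst : dist s t < δ := by
      rw [Real.dist_eq, abs_lt]
      constructor <;> linarith [hs.1, hs.2]
    simpa [Real.dist_eq] using hHδ s hst
  refine ⟨Icc q r, Icc_mem_nhds hqt htr, ?_⟩
  filter_upwards [Metric.tendsto_nhds.1 (hlim q) (ε / 3) (by positivity),
    Metric.tendsto_nhds.1 (hlim r) (ε / 3) (by positivity)] with n hnq hnr s hs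
  have hqr : (q : ℝ) ≤ r := hs.1.trans hs.2
  have h1 := abs_lt.1 (hnear s hs)
  have h2 := abs_lt.1 (hnear q ⟨le_rfl, hqr⟩)
  have h3 := abs_lt.1 (hnear r ⟨hqr, le_rfl⟩)
  rw [Real.dist_eq] at hnq hnr
  have h4 := abs_lt.1 hnq
  have h5 := abs_lt.1 hnr
  have h6 := hanti n hs.1
  have h7 := hanti n hs.2
  rw [Real.dist_eq, abs_lt]
  constructor <;> linarith

/-- Uniformly close objectives have close infima. -/
lemma abs_csInf_image_sub_csInf_image_le {α : Type*} {K : Set α} (hK : K.Nonempty)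
    {f g : α → ℝ} {δ : ℝ} (hf : BddBelow (f '' K)) (hfg : ∀ x ∈ K, |f x - g x| ≤ δ) :
    |sInf (f '' K) - sInf (g '' K)| ≤ δ := by
  have hlow : ∀ x ∈ K, sInf (f '' K) - δ ≤ g x := fun x hx => by
    linarith [csInf_le hf (mem_image_of_mem f hx), (abs_le.1 (hfg x hx)).2]
  have hg : BddBelow (g '' K) := ⟨sInf (f '' K) - δ, by rintro _ ⟨x, hx, rfl⟩; exact hlow x hx⟩
  have h1 : sInf (f '' K) - δ ≤ sInf (g '' K) :=
    le_csInf (hK.image g) (by rintro _ ⟨x, hx, rfl⟩; exact hlow x hx)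
  have h2 : sInf (g '' K) - δ ≤ sInf (f '' K) := by
    refine le_csInf (hK.image f) ?_
    rintro _ ⟨x, hx, rfl⟩
    linarith [csInf_le hg (mem_image_of_mem g hx), (abs_le.1 (hfg x hx)).1]
  rw [abs_le]
  constructor <;> linarith

lemma TendstoUniformlyOn.tendsto_csInf_image {ι α : Type*} {p : Filter ι} {K : Set α}
    (hK : K.Nonempty) {f : ι → α → ℝ} {g : α → ℝ} (hg : BddBelow (g '' K))
    (hfg : TendstoUniformlyOn f g p K) :
    Tendsto (fun n => sInf (f n '' K)) p (nhds (sInf (g '' K))) := by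
  rw [Metric.tendsto_nhds]
  intro ε hε
  filter_upwards [Metric.tendstoUniformlyOn_iff.1 hfg (ε / 2) (by positivity)] with n hn
  rw [dist_comm, Real.dist_eq]
  have := abs_csInf_image_sub_csInf_image_le hK hg (g := f n) (δ := ε / 2)
    fun x hx => by simpa [Real.dist_eq] using (hn x hx).le
  linarith

/-- Under uniform convergence on a compact set to a continuous objective, the minimizers are
eventually within any prescribed distance of the minimizers of the limit. -/
lemma TendstoUniformlyOn.eventually_infDist_minimizers_lt {ι α : Type*} [PseudoMetricSpace α]
    {p : Filter ι} {K : Set α} (hK : IsCompact K) {f : ι → α → ℝ} {g : α → ℝ}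
    (hg : ContinuousOn g K) (hfg : TendstoUniformlyOn f g p K) {ε : ℝ} (hε : 0 < ε) :
    ∀ᶠ n in p, ∀ x ∈ K, f n x = sInf (f n '' K) →
      Metric.infDist x {y ∈ K | g y = sInf (g '' K)} < ε := by
  set S := {y ∈ K | g y = sInf (g '' K)}
  have hbdd : BddBelow (g '' K) := (hK.image_of_continuousOn hg).bddBelow
  have hfar : IsCompact (K ∩ {x | ε ≤ Metric.infDist x S}) :=
    hK.inter_right (isClosed_le continuous_const (Metric.continuous_infDist_pt S))
  rcases (K ∩ {x | ε ≤ Metric.infDist x S}).eq_empty_or_nonempty with hem | hne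
  · refine Eventually.of_forall fun n x hx _ => ?_
    by_contra! hlt
    exact (hem ▸ (⟨hx, hlt⟩ : x ∈ K ∩ {x | ε ≤ Metric.infDist x S}) : x ∈ (∅ : Set α))
  obtain ⟨z, ⟨hzK, hzε⟩, hz⟩ := hfar.exists_isMinOn hne (hg.mono inter_subset_left)
  have hgap : sInf (g '' K) < g z := by
    refine lt_of_le_of_ne (csInf_le hbdd (mem_image_of_mem g hzK)) fun heq => ?_
    have hzS : z ∈ S := ⟨hzK, heq.symm⟩
    have := Metric.infDist_zero_of_mem hzS
    simp only [mem_ofPred_eq] at hzε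
    linarith
  set η := (g z - sInf (g '' K)) / 2 with hη
  have hηpos : 0 < η := by simp only [hη]; linarith
  filter_upwards [Metric.tendstoUniformlyOn_iff.1 hfg η hηpos,
    Metric.tendsto_nhds.1 (hfg.tendsto_csInf_image ⟨z, hzK⟩ hbdd) η hηpos] with n hn hinf x hx hmin
  by_contra! hlt
  have h1 : g z ≤ g x := hz ⟨hx, hlt⟩
  have h2 := hn x hx
  rw [Real.dist_eq, abs_lt] at h2 hinf
  linarith [h2.2, hinf.2]

/-- Uniform strong law of large numbers for the translates of a monotone continuous function
over a compact interval. -/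
lemma ae_tendstoUniformlyOn_average_translate {Ω : Type*} [MeasurableSpace Ω] {P : Measure Ω}
    {l : ℝ → ℝ} (hl_mono : Monotone l) (hl_cont : Continuous l) {a b : ℝ} (hab : a ≤ b)
    {ξ : Ω → ℝ} {ξs : ℕ → Ω → ℝ}
    (hiid : iIndepFun ξs P) (hident : ∀ i, IdentDistrib (ξs i) ξ P P)
    (hint : ∀ t ∈ Icc a b, Integrable (fun ω => l (ξ ω - t)) P) :
    ContinuousOn (fun t => ∫ ω, l (ξ ω - t) ∂P) (Icc a b) ∧
    ∀ᵐ ω ∂P, TendstoUniformlyOn (fun (n : ℕ) t => (∑ i ∈ Finset.range n, l (ξs i ω - t)) / n)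
      (fun t => ∫ ω, l (ξ ω - t) ∂P) atTop (Icc a b) := by
  have hcont : ContinuousOn (fun t => ∫ ω, l (ξ ω - t) ∂P) (Icc a b) := by
    refine continuousOn_of_dominated (bound := fun ω => |l (ξ ω - a)| + |l (ξ ω - b)|)
      (fun t ht => (hint t ht).aestronglyMeasurable) (fun t ht => ?_)
      ((hint a ⟨le_rfl, hab⟩).abs.add (hint b ⟨hab, le_rfl⟩).abs) (ae_of_all _ fun ω => ?_)
    · refine ae_of_all _ fun ω => ?_
      have h1 : l (ξ ω - t) ≤ l (ξ ω - a) := hl_mono (by linarith [ht.1])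
      have h2 : l (ξ ω - b) ≤ l (ξ ω - t) := hl_mono (by linarith [ht.2])
      rw [Real.norm_eq_abs, abs_le]
      constructor
      · linarith [neg_abs_le (l (ξ ω - b)), abs_nonneg (l (ξ ω - a))]
      · linarith [le_abs_self (l (ξ ω - a)), abs_nonneg (l (ξ ω - b))]
    · exact (hl_cont.comp (continuous_const.sub continuous_id)).continuousOn
  refine ⟨hcont, ?_⟩
  have hslln : ∀ t ∈ Icc a b, ∀ᵐ ω ∂P,
      Tendsto (fun n : ℕ => (∑ i ∈ Finset.range n, l (ξs i ω - t)) / n) atTop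
        (nhds (∫ ω, l (ξ ω - t) ∂P)) := by
    intro t ht
    have hmeas : Measurable fun x : ℝ => l (x - t) :=
      (hl_cont.comp (continuous_id.sub continuous_const)).measurable
    have hid : ∀ i, IdentDistrib (fun ω => l (ξs i ω - t)) (fun ω => l (ξ ω - t)) P P :=
      fun i => (hident i).comp hmeas
    rw [← (hid 0).integral_eq]
    exact strong_law_ae_real (fun i ω => l (ξs i ω - t)) ((hid 0).integrable_iff.2 (hint t ht))
      (fun i j hij => (hiid.indepFun hij).comp hmeas hmeas) fun i => (hid i).trans (hid 0).symm
  have hrat : ∀ᵐ ω ∂P, ∀ q : ℚ,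
      Tendsto (fun n : ℕ => (∑ i ∈ Finset.range n, l (ξs i ω - projIcc a b hab q)) / n) atTop
        (nhds (∫ ω, l (ξ ω - projIcc a b hab q) ∂P)) :=
    ae_all_iff.2 fun q => hslln _ (projIcc a b hab q).2
  filter_upwards [hrat] with ω hω
  have hloc := tendstoLocallyUniformly_of_antitone_of_tendsto_rat
    (h := fun (n : ℕ) t => (∑ i ∈ Finset.range n, l (ξs i ω - projIcc a b hab t)) / n)
    (H := fun t => ∫ ω, l (ξ ω - projIcc a b hab t) ∂P)
    (fun n s t hst => by
      have hproj : (projIcc a b hab s : ℝ) ≤ projIcc a b hab t := monotone_projIcc hab hst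
      dsimp only
      gcongr with i
      exact hl_mono (by linarith))
    (hcont.comp_continuous (continuous_subtype_val.comp continuous_projIcc)
      fun t => (projIcc a b hab t).2) hω
  have hunif := (tendstoLocallyUniformlyOn_iff_tendstoUniformlyOn_of_compact
    isCompact_Icc).1 (hloc.tendstoLocallyUniformlyOn (s := Icc a b))
  refine (hunif.congr ?_).congr_right ?_
  · exact Eventually.of_forall fun n t ht => by simp only [projIcc_of_mem hab ht]
  · exact fun t ht => by simp only [projIcc_of_mem hab ht]

/-- Consistency of the SAA estimators of the OCE risk measure:
`v_n → v*` w.p.1, the deviation `D(S_n, S) = sup_{x ∈ S_n} inf_{y ∈ S} |x - y|`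
converges to `0` w.p.1, and if `S = {t*}` is a singleton then any measurable
selection `t_n ∈ S_n` converges to `t*` w.p.1. -/
theorem oce_saa_consistency
    {Ω : Type*} [MeasurableSpace Ω] (P : Measure Ω) [IsProbabilityMeasure P]
    -- the loss function: proper closed convex and nondecreasing (hence continuous)
    (l : ℝ → ℝ) (hl_conv : ConvexOn ℝ Set.univ l) (hl_mono : Monotone l)
    (hl_cont : Continuous l)
    -- the compact interval T = [a, b]
    (a b : ℝ) (hab : a ≤ b)
    -- the random loss ξ and the i.i.d. observations ξ₁, ξ₂, …
    (ξ : Ω → ℝ) (hξ : Measurable ξ)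
    (ξs : ℕ → Ω → ℝ) (hξs : ∀ i, Measurable (ξs i))
    (hiid : iIndepFun ξs P)
    (hident : ∀ i, IdentDistrib (ξs i) ξ P P)
    -- integrability and `sup_{t ∈ T} E[l(ξ - t)²] < +∞`
    (hint : ∀ t ∈ Icc a b, Integrable (fun ω => (l (ξ ω - t)) ^ 2) P)
    (hbdd : BddAbove ((fun t => ∫ ω, (l (ξ ω - t)) ^ 2 ∂P) '' Icc a b))
    -- the true problem: objective, optimal value, set of optimal solutions
    (F : ℝ → ℝ) (hF : ∀ t, F t = t + ∫ ω, l (ξ ω - t) ∂P)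
    (vstar : ℝ) (hvstar : vstar = sInf (F '' Icc a b))
    (S : Set ℝ) (hS : S = {t ∈ Icc a b | F t = vstar})
    -- the SAA problem: empirical objective, optimal value, set of optimal solutions
    (Fn : ℕ → Ω → ℝ → ℝ)
    (hFn : ∀ n ω t, Fn n ω t = t + (∑ i ∈ Finset.range n, l (ξs i ω - t)) / n)
    (vn : ℕ → Ω → ℝ) (hvn : ∀ n ω, vn n ω = sInf (Fn n ω '' Icc a b))
    (Sn : ℕ → Ω → Set ℝ) (hSn : ∀ n ω, Sn n ω = {t ∈ Icc a b | Fn n ω t = vn n ω}) :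
    (∀ᵐ ω ∂P, Tendsto (fun n => vn n ω) atTop (nhds vstar)) ∧
    (∀ᵐ ω ∂P,
      Tendsto (fun n => sSup ((fun x => Metric.infDist x S) '' Sn n ω)) atTop (nhds 0)) ∧
    (∀ tstar : ℝ, S = {tstar} →
      ∀ tn : ℕ → Ω → ℝ, (∀ n ω, tn n ω ∈ Sn n ω) →
        ∀ᵐ ω ∂P, Tendsto (fun n => tn n ω) atTop (nhds tstar)) := by
  have hint_l : ∀ t ∈ Icc a b, Integrable (fun ω => l (ξ ω - t)) P := fun t ht =>
    ((memLp_two_iff_integrable_sq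
      (hl_cont.measurable.comp (hξ.sub_const t)).aestronglyMeasurable).2
      (hint t ht)).integrable one_le_two
  obtain ⟨hcont, hunif⟩ :=
    ae_tendstoUniformlyOn_average_translate hl_mono hl_cont hab hiid hident hint_l
  have hF_cont : ContinuousOn F (Icc a b) :=
    (continuousOn_id.add hcont).congr fun t _ => hF t
  have hFn_unif : ∀ᵐ ω ∂P, TendstoUniformlyOn (fun n => Fn n ω) F atTop (Icc a b) := by
    filter_upwards [hunif] with ω hω
    rw [Metric.tendstoUniformlyOn_iff] at hω ⊢
    intro ε hε
    filter_upwards [hω ε hε] with n hn t ht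
    simpa [hF, hFn] using hn t ht
  have hdev : ∀ᵐ ω ∂P, ∀ ε > 0, ∀ᶠ n in atTop, ∀ x ∈ Sn n ω, Metric.infDist x S < ε := by
    filter_upwards [hFn_unif] with ω hω ε hε
    filter_upwards [hω.eventually_infDist_minimizers_lt isCompact_Icc hF_cont hε] with n hn x hx
    rw [hSn, hvn] at hx
    rw [hS, hvstar]
    exact hn x hx.1 hx.2
  refine ⟨?_, ?_, ?_⟩
  · filter_upwards [hFn_unif] with ω hω
    simp only [hvn, hvstar]
    exact hω.tendsto_csInf_image (nonempty_Icc.2 hab)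
      (isCompact_Icc.image_of_continuousOn hF_cont).bddBelow
  · filter_upwards [hdev] with ω hω
    rw [Metric.tendsto_nhds]
    intro ε hε
    filter_upwards [hω (ε / 2) (by positivity)] with n hn
    have hle : sSup ((fun x => Metric.infDist x S) '' Sn n ω) ≤ ε / 2 :=
      Real.sSup_le (by rintro _ ⟨x, hx, rfl⟩; exact (hn x hx).le) (by positivity)
    have hnonneg : 0 ≤ sSup ((fun x => Metric.infDist x S) '' Sn n ω) :=
      Real.sSup_nonneg (by rintro _ ⟨x, -, rfl⟩; exact Metric.infDist_nonneg)
    rw [Real.dist_eq, sub_zero, abs_of_nonneg hnonneg]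
    linarith
  · intro tstar hsing tn htn
    filter_upwards [hdev] with ω hω
    rw [Metric.tendsto_nhds]
    intro ε hε
    filter_upwards [hω ε hε] with n hn
    simpa [hsing] using hn _ (htn n ω)
end

section
/- Suppose that sup_{t∈T} E[l(ξ−t)²] < +∞, that there exists a random variable K(ξ) with E[K(ξ)²] < ∞ such that |l(ξ−t₁)−l(ξ−t₂)| ≤ K(ξ)|t₁−t₂| for all t₁,t₂ ∈ T and almost every ξ, and that the problem minimize_{t∈T} t + E[l(ξ−t)] has a unique optimal solution t*. Let t_n be an optimal solution of the sample average approximation over an i.i.d. sample ξ_1,…,ξ_n, and define σ²_n = (1/n)∑_{i=1}^n l²(ξ_i−t_n) − ((1/n)∑_{i=1}^n l(ξ_i−t_n))². Then σ²_n → σ²(t*) = Var[l(ξ−t*)] with probability 1. -/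
open MeasureTheory ProbabilityTheory Filter Set

/-- Strong law of large numbers for a measurable function of an i.i.d. sample. -/
lemma ae_tendsto_sampleMean
    {Ω : Type*} [MeasurableSpace Ω] {P : Measure Ω}
    {ξ : Ω → ℝ} {ξs : ℕ → Ω → ℝ} (hiid : iIndepFun ξs P)
    (hident : ∀ i, IdentDistrib (ξs i) ξ P P)
    {g : ℝ → ℝ} (hg : Measurable g) (hint : Integrable (fun ω => g (ξ ω)) P) :
    ∀ᵐ ω ∂P, Tendsto (fun n : ℕ => (∑ i ∈ Finset.range n, g (ξs i ω)) / n) atTop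
      (nhds (∫ ω, g (ξ ω) ∂P)) := by
  have hid : ∀ i, IdentDistrib (fun ω => g (ξs i ω)) (fun ω => g (ξ ω)) P P :=
    fun i => (hident i).comp hg
  have h := strong_law_ae_real (μ := P) (fun i ω => g (ξs i ω))
    ((hid 0).integrable_iff.2 hint)
    (fun i j hij => (hiid.indepFun hij).comp hg hg)
    (fun i => (hid i).trans (hid 0).symm)
  rwa [(hid 0).integral_eq] at h

/-- A monotone function of `ξ - t` is integrable for `t ∈ [a, b]` as soon as it is at the
endpoints. -/
lemma integrable_monotone_sub
    {Ω : Type*} [MeasurableSpace Ω] {P : Measure Ω}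
    {φ : ℝ → ℝ} (hφ : Monotone φ) {ξ : Ω → ℝ} (hξ : Measurable ξ) {a b : ℝ}
    (ha : Integrable (fun ω => φ (ξ ω - a)) P) (hb : Integrable (fun ω => φ (ξ ω - b)) P)
    {t : ℝ} (ht : t ∈ Icc a b) : Integrable (fun ω => φ (ξ ω - t)) P := by
  refine integrable_of_le_of_le
    (hφ.measurable.comp (hξ.sub_const t)).aestronglyMeasurable
    (ae_of_all _ fun ω => hφ ?_) (ae_of_all _ fun ω => hφ ?_) hb ha
  · linarith [ht.2]
  · linarith [ht.1]

lemma continuousOn_integral_monotone_sub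
    {Ω : Type*} [MeasurableSpace Ω] {P : Measure Ω}
    {φ : ℝ → ℝ} (hφ : Monotone φ) (hφc : Continuous φ) {ξ : Ω → ℝ} (hξ : Measurable ξ) {a b : ℝ}
    (ha : Integrable (fun ω => φ (ξ ω - a)) P) (hb : Integrable (fun ω => φ (ξ ω - b)) P) :
    ContinuousOn (fun t => ∫ ω, φ (ξ ω - t) ∂P) (Icc a b) := by
  refine continuousOn_of_dominated
    (bound := fun ω => |φ (ξ ω - a)| + |φ (ξ ω - b)|)
    (fun t _ => (hφ.measurable.comp (hξ.sub_const t)).aestronglyMeasurable)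
    (fun t ht => ae_of_all _ fun ω => ?_) (ha.abs.add hb.abs)
    (ae_of_all _ fun ω => by fun_prop)
  have h₁ : φ (ξ ω - b) ≤ φ (ξ ω - t) := hφ (by linarith [ht.2])
  have h₂ : φ (ξ ω - t) ≤ φ (ξ ω - a) := hφ (by linarith [ht.1])
  rw [Real.norm_eq_abs, abs_le]
  constructor
  · linarith [neg_abs_le (φ (ξ ω - b)), abs_nonneg (φ (ξ ω - a))]
  · linarith [le_abs_self (φ (ξ ω - a)), abs_nonneg (φ (ξ ω - b))]

/-- A sequence in `[a, b]` converging to `c` from the left, strictly so except at `a`. -/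
lemma exists_seq_left {a b c : ℝ} (hc : c ∈ Icc a b) :
    ∃ p : ℕ → ℝ, (∀ k, p k ∈ Icc a b) ∧ (∀ k, p k = a ∨ p k < c) ∧
      Tendsto p atTop (nhds c) := by
  refine ⟨fun k => max a (c - 1 / ((k : ℝ) + 1)), fun k => ?_, fun k => ?_, ?_⟩
  · have : 0 < 1 / ((k : ℝ) + 1) := by positivity
    exact ⟨le_max_left _ _, max_le (hc.1.trans hc.2) (by linarith [hc.2])⟩
  · have : 0 < 1 / ((k : ℝ) + 1) := by positivity
    rcases max_choice a (c - 1 / ((k : ℝ) + 1)) with h | h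
    · exact Or.inl h
    · exact Or.inr (by simp only [h]; linarith)
  · have h := (tendsto_const_nhds (x := a)).max
      ((tendsto_const_nhds (x := c)).sub (tendsto_one_div_add_atTop_nhds_zero_nat (𝕜 := ℝ)))
    simpa [hc.1] using h

/-- A sequence in `[a, b]` converging to `c` from the right, strictly so except at `b`. -/
lemma exists_seq_right {a b c : ℝ} (hc : c ∈ Icc a b) :
    ∃ q : ℕ → ℝ, (∀ k, q k ∈ Icc a b) ∧ (∀ k, q k = b ∨ c < q k) ∧
      Tendsto q atTop (nhds c) := by
  obtain ⟨p, hp, hp', hpc⟩ := exists_seq_left (a := -b) (b := -a) (c := -c)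
    ⟨neg_le_neg hc.2, neg_le_neg hc.1⟩
  refine ⟨fun k => -p k, fun k => ⟨by linarith [(hp k).2], by linarith [(hp k).1]⟩,
    fun k => ?_, by simpa using hpc.neg⟩
  rcases hp' k with h | h
  · exact Or.inl (by simp [h])
  · exact Or.inr (by linarith)

/-- Sample means of a monotone function, evaluated at a convergent sequence of shifts. -/
lemma ae_tendsto_sampleMean_of_tendsto
    {Ω : Type*} [MeasurableSpace Ω] {P : Measure Ω}
    {ξ : Ω → ℝ} (hξ : Measurable ξ) {ξs : ℕ → Ω → ℝ} (hiid : iIndepFun ξs P)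
    (hident : ∀ i, IdentDistrib (ξs i) ξ P P)
    {φ : ℝ → ℝ} (hφ : Monotone φ) (hφc : Continuous φ) {a b c : ℝ} (hc : c ∈ Icc a b)
    (ha : Integrable (fun ω => φ (ξ ω - a)) P) (hb : Integrable (fun ω => φ (ξ ω - b)) P) :
    ∀ᵐ ω ∂P, ∀ t : ℕ → ℝ, (∀ n, t n ∈ Icc a b) → Tendsto t atTop (nhds c) →
      Tendsto (fun n : ℕ => (∑ i ∈ Finset.range n, φ (ξs i ω - t n)) / n) atTop
        (nhds (∫ ω, φ (ξ ω - c) ∂P)) := by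
  obtain ⟨p, hp, hp', hpc⟩ := exists_seq_left hc
  obtain ⟨q, hq, hq', hqc⟩ := exists_seq_right hc
  have hslln : ∀ s ∈ Icc a b, ∀ᵐ ω ∂P,
      Tendsto (fun n : ℕ => (∑ i ∈ Finset.range n, φ (ξs i ω - s)) / n) atTop
        (nhds (∫ ω, φ (ξ ω - s) ∂P)) := fun s hs =>
    ae_tendsto_sampleMean hiid hident (g := fun x => φ (x - s))
      (hφ.measurable.comp (measurable_id.sub_const s)) (integrable_monotone_sub hφ hξ ha hb hs)
  have hcont := continuousOn_integral_monotone_sub hφ hφc hξ ha hb c hc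
  have hGp := hcont.tendsto.comp (tendsto_nhdsWithin_iff.2 ⟨hpc, Eventually.of_forall hp⟩)
  have hGq := hcont.tendsto.comp (tendsto_nhdsWithin_iff.2 ⟨hqc, Eventually.of_forall hq⟩)
  filter_upwards [ae_all_iff.2 fun k => hslln (p k) (hp k),
    ae_all_iff.2 fun k => hslln (q k) (hq k)] with ω hωp hωq t ht htc
  refine tendsto_order.2 ⟨fun y hy => ?_, fun y hy => ?_⟩
  · obtain ⟨k, hk⟩ := (hGq.eventually_const_lt hy).exists
    have hle : ∀ᶠ n in atTop, t n ≤ q k := by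
      rcases hq' k with h | h
      · exact Eventually.of_forall fun n => h ▸ (ht n).2
      · exact (htc.eventually_lt_const h).mono fun n hn => hn.le
    filter_upwards [hle, (hωq k).eventually_const_lt hk] with n hn hlt
    refine hlt.trans_le ?_
    gcongr with i
    exact hφ (by linarith)
  · obtain ⟨k, hk⟩ := (hGp.eventually_lt_const hy).exists
    have hle : ∀ᶠ n in atTop, p k ≤ t n := by
      rcases hp' k with h | h
      · exact Eventually.of_forall fun n => h ▸ (ht n).1
      · exact (htc.eventually_const_lt h).mono fun n hn => hn.le
    filter_upwards [hle, (hωp k).eventually_lt_const hk] with n hn hlt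
    refine lt_of_le_of_lt ?_ hlt
    gcongr with i
    exact hφ (by linarith)

/-- Minimizers over `[a, b]` of convex functions `f n` converge to the unique minimizer `c` of
`F`, if `f n` converges to `F` at `c` and along sequences approaching `c` from both sides. -/
lemma tendsto_minimizer_of_convexOn
    {f : ℕ → ℝ → ℝ} (hf : ∀ n, ConvexOn ℝ univ (f n)) {F : ℝ → ℝ} {a b c : ℝ}
    (hF : ∀ t ∈ Icc a b, t ≠ c → F c < F t)
    {p q : ℕ → ℝ} (hp : ∀ k, p k ∈ Icc a b) (hp' : ∀ k, p k = a ∨ p k < c)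
    (hpc : Tendsto p atTop (nhds c))
    (hq : ∀ k, q k ∈ Icc a b) (hq' : ∀ k, q k = b ∨ c < q k)
    (hqc : Tendsto q atTop (nhds c))
    (hfc : Tendsto (fun n => f n c) atTop (nhds (F c)))
    (hfp : ∀ k, Tendsto (fun n => f n (p k)) atTop (nhds (F (p k))))
    (hfq : ∀ k, Tendsto (fun n => f n (q k)) atTop (nhds (F (q k))))
    {t : ℕ → ℝ} (ht : ∀ n, t n ∈ Icc a b) (hmin : ∀ n, f n (t n) ≤ f n c) :
    Tendsto t atTop (nhds c) := by
  refine tendsto_order.2 ⟨fun y hy => ?_, fun y hy => ?_⟩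
  · obtain ⟨k, hk⟩ := (hpc.eventually_const_lt hy).exists
    rcases hp' k with h | h
    · exact Eventually.of_forall fun n => hk.trans_le (h ▸ (ht n).1)
    · filter_upwards [hfc.eventually_lt (hfp k) (hF _ (hp k) h.ne)] with n hn
      refine hk.trans (lt_of_not_ge fun hle => ?_)
      have := (hf n).le_max_of_mem_Icc (mem_univ (t n)) (mem_univ c) ⟨hle, h.le⟩
      exact absurd (this.trans (max_le (hmin n) le_rfl)) hn.not_ge
  · obtain ⟨k, hk⟩ := (hqc.eventually_lt_const hy).exists
    rcases hq' k with h | h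
    · exact Eventually.of_forall fun n => lt_of_le_of_lt (h ▸ (ht n).2) hk
    · filter_upwards [hfc.eventually_lt (hfq k) (hF _ (hq k) h.ne')] with n hn
      refine lt_trans (lt_of_not_ge fun hle => ?_) hk
      have := (hf n).le_max_of_mem_Icc (mem_univ c) (mem_univ (t n)) ⟨h.le, hle⟩
      exact absurd (this.trans (max_le le_rfl (hmin n))) hn.not_ge

lemma convexOn_add_sampleMean {l : ℝ → ℝ} (hl : ConvexOn ℝ univ l) (x : ℕ → ℝ) (n : ℕ) :
    ConvexOn ℝ univ (fun t => t + (∑ i ∈ Finset.range n, l (x i - t)) / n) := by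
  refine ⟨convex_univ, fun s _ t _ α β hα hβ hαβ => ?_⟩
  have key : ∑ i ∈ Finset.range n, l (x i - (α * s + β * t)) ≤
      α * ∑ i ∈ Finset.range n, l (x i - s) + β * ∑ i ∈ Finset.range n, l (x i - t) := by
    rw [Finset.mul_sum, Finset.mul_sum, ← Finset.sum_add_distrib]
    refine Finset.sum_le_sum fun i _ => ?_
    have h := hl.2 (mem_univ (x i - s)) (mem_univ (x i - t)) hα hβ hαβ
    simp only [smul_eq_mul] at h
    convert h using 2
    linear_combination (-x i) * hαβ
  have := div_le_div_of_nonneg_right key (Nat.cast_nonneg (α := ℝ) n)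
  simp only [smul_eq_mul]
  calc _ ≤ _ := add_le_add_right this _
    _ = _ := by ring

/-- Strong consistency of the plug-in variance estimator
`σ²_n = (1/n)∑ l²(ξᵢ - t_n) - ((1/n)∑ l(ξᵢ - t_n))²` for `σ²(t*) = Var[l(ξ - t*)]`,
where `t_n` is an SAA optimal solution and `t*` is the unique optimal solution of
the OCE problem `min_{t ∈ T} t + E[l(ξ - t)]`. -/
theorem oce_variance_estimator_consistency
    {Ω : Type*} [MeasurableSpace Ω] (P : Measure Ω) [IsProbabilityMeasure P]
    (l : ℝ → ℝ) (hl_conv : ConvexOn ℝ Set.univ l) (hl_mono : Monotone l)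
    (hl_cont : Continuous l)
    (a b : ℝ) (hab : a ≤ b)
    (ξ : Ω → ℝ) (hξ : Measurable ξ)
    (ξs : ℕ → Ω → ℝ) (hξs : ∀ i, Measurable (ξs i))
    (hiid : iIndepFun ξs P)
    (hident : ∀ i, IdentDistrib (ξs i) ξ P P)
    -- `sup_{t ∈ T} E[l(ξ - t)²] < +∞`
    (hint : ∀ t ∈ Icc a b, Integrable (fun ω => (l (ξ ω - t)) ^ 2) P)
    (hbdd : BddAbove ((fun t => ∫ ω, (l (ξ ω - t)) ^ 2 ∂P) '' Icc a b))
    -- Lipschitz condition with square-integrable modulus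
    (K : Ω → ℝ) (hK2 : Integrable (fun ω => (K ω) ^ 2) P)
    (hLip : ∀ᵐ ω ∂P, ∀ t₁ ∈ Icc a b, ∀ t₂ ∈ Icc a b,
      |l (ξ ω - t₁) - l (ξ ω - t₂)| ≤ K ω * |t₁ - t₂|)
    -- the true problem and its unique optimal solution t*
    (F : ℝ → ℝ) (hF : ∀ t, F t = t + ∫ ω, l (ξ ω - t) ∂P)
    (tstar : ℝ) (htstar : tstar ∈ Icc a b)
    (hunique : ∀ t ∈ Icc a b, t ≠ tstar → F tstar < F t)
    -- the SAA problem and an optimal solution t_n of it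
    (Fn : ℕ → Ω → ℝ → ℝ)
    (hFn : ∀ n ω t, Fn n ω t = t + (∑ i ∈ Finset.range n, l (ξs i ω - t)) / n)
    (tn : ℕ → Ω → ℝ)
    (htn : ∀ n ω, tn n ω ∈ Icc a b ∧ ∀ t ∈ Icc a b, Fn n ω (tn n ω) ≤ Fn n ω t)
    -- the plug-in variance estimator
    (σsqn : ℕ → Ω → ℝ)
    (hσsqn : ∀ n ω, σsqn n ω =
      (∑ i ∈ Finset.range n, (l (ξs i ω - tn n ω)) ^ 2) / n -
        ((∑ i ∈ Finset.range n, l (ξs i ω - tn n ω)) / n) ^ 2) :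
    ∀ᵐ ω ∂P, Tendsto (fun n => σsqn n ω) atTop
      (nhds (variance (fun ω' => l (ξ ω' - tstar)) P)) := by
  have hmeas : ∀ t, AEStronglyMeasurable (fun ω => l (ξ ω - t)) P := fun t =>
    (hl_mono.measurable.comp (hξ.sub_const t)).aestronglyMeasurable
  have hL2 : ∀ t ∈ Icc a b, MemLp (fun ω => l (ξ ω - t)) 2 P := fun t ht =>
    (memLp_two_iff_integrable_sq (hmeas t)).2 (hint t ht)
  have hL1 : ∀ t ∈ Icc a b, Integrable (fun ω => l (ξ ω - t)) P := fun t ht =>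
    (hL2 t ht).integrable one_le_two
  have ha : a ∈ Icc a b := left_mem_Icc.2 hab
  have hb : b ∈ Icc a b := right_mem_Icc.2 hab
  -- `l ^ 2 = u - v` with `u = (max l 0) ^ 2` and `v = -(min l 0) ^ 2` both nondecreasing
  have hu_mono : Monotone fun x => (max (l x) 0) ^ 2 := fun x y hxy =>
    pow_le_pow_left₀ (le_max_right _ _) (max_le_max_right 0 (hl_mono hxy)) 2
  have hv_mono : Monotone fun x => -(min (l x) 0) ^ 2 := fun x y hxy => by
    have h₁ : min (l x) 0 ≤ min (l y) 0 := min_le_min_right 0 (hl_mono hxy)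
    have h₂ : min (l y) 0 ≤ 0 := min_le_right _ _
    simp only
    nlinarith
  have hsplit : ∀ x, (l x) ^ 2 = (max (l x) 0) ^ 2 - -(min (l x) 0) ^ 2 := fun x => by
    rcases le_total (l x) 0 with h | h <;> simp [h]
  have hu_cont : Continuous fun x => (max (l x) 0) ^ 2 := by fun_prop
  have hv_cont : Continuous fun x => -(min (l x) 0) ^ 2 := by fun_prop
  have hu_int : ∀ t ∈ Icc a b, Integrable (fun ω => (max (l (ξ ω - t)) 0) ^ 2) P :=
    fun t ht => (hint t ht).mono'
      (hu_mono.measurable.comp (hξ.sub_const t)).aestronglyMeasurable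
      (ae_of_all _ fun ω => by
        rw [Real.norm_of_nonneg (sq_nonneg _), hsplit]
        linarith [sq_nonneg (min (l (ξ ω - t)) 0)])
  have hv_int : ∀ t ∈ Icc a b, Integrable (fun ω => -(min (l (ξ ω - t)) 0) ^ 2) P :=
    fun t ht => (hint t ht).mono'
      (hv_mono.measurable.comp (hξ.sub_const t)).aestronglyMeasurable
      (ae_of_all _ fun ω => by
        rw [norm_neg, Real.norm_of_nonneg (sq_nonneg _), hsplit]
        linarith [sq_nonneg (max (l (ξ ω - t)) 0)])
  have hvar : variance (fun ω' => l (ξ ω' - tstar)) P =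
      ((∫ ω, (max (l (ξ ω - tstar)) 0) ^ 2 ∂P) - ∫ ω, -(min (l (ξ ω - tstar)) 0) ^ 2 ∂P) -
        (∫ ω, l (ξ ω - tstar) ∂P) ^ 2 := by
    rw [variance_eq_sub (hL2 tstar htstar),
      ← integral_sub (hu_int tstar htstar) (hv_int tstar htstar)]
    simp only [Pi.pow_apply, hsplit]
  obtain ⟨p, hp, hp', hpc⟩ := exists_seq_left htstar
  obtain ⟨q, hq, hq', hqc⟩ := exists_seq_right htstar
  have hFn_tendsto : ∀ s ∈ Icc a b, ∀ᵐ ω ∂P,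
      Tendsto (fun n => Fn n ω s) atTop (nhds (F s)) := fun s hs => by
    filter_upwards [ae_tendsto_sampleMean hiid hident (g := fun x => l (x - s))
      (hl_mono.measurable.comp (measurable_id.sub_const s)) (hL1 s hs)] with ω hω
    simp only [hFn, hF]
    exact hω.const_add s
  have hFn_conv : ∀ n ω, ConvexOn ℝ univ (Fn n ω) := fun n ω => by
    rw [funext (hFn n ω)]
    exact convexOn_add_sampleMean hl_conv (fun i => ξs i ω) n
  filter_upwards [hFn_tendsto tstar htstar, ae_all_iff.2 fun k => hFn_tendsto (p k) (hp k),
    ae_all_iff.2 fun k => hFn_tendsto (q k) (hq k),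
    ae_tendsto_sampleMean_of_tendsto hξ hiid hident hl_mono hl_cont htstar (hL1 a ha) (hL1 b hb),
    ae_tendsto_sampleMean_of_tendsto hξ hiid hident hu_mono hu_cont htstar
      (hu_int a ha) (hu_int b hb),
    ae_tendsto_sampleMean_of_tendsto hξ hiid hident hv_mono hv_cont htstar
      (hv_int a ha) (hv_int b hb)] with ω hωc hωp hωq hωl hωu hωv
  have hmem : ∀ n, tn n ω ∈ Icc a b := fun n => (htn n ω).1
  have htend : Tendsto (fun n => tn n ω) atTop (nhds tstar) :=
    tendsto_minimizer_of_convexOn (fun n => hFn_conv n ω) hunique hp hp' hpc hq hq' hqc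
      hωc hωp hωq hmem fun n => (htn n ω).2 tstar htstar
  have h := ((hωu _ hmem htend).sub (hωv _ hmem htend)).sub ((hωl _ hmem htend).pow 2)
  rw [hvar]
  refine h.congr fun n => ?_
  rw [hσsqn, ← sub_div, ← Finset.sum_sub_distrib]
  simp only [hsplit]
end

section
/- Let t* = SR_{l,λ}(ξ) be the utility-based shortfall risk of the random loss ξ, i.e., the optimal value of: minimize_{t∈T} t subject to E[l(ξ−t)] ≤ λ, and let t_n be the optimal value of its sample average approximation minimize_{t∈T} t subject to (1/n)∑_{j=1}^n l(ξ_j−t) ≤ λ over an i.i.d. sample ξ_1,…,ξ_n. Suppose: (i) there exist t_l, t_u ∈ ℝ with E[l(ξ−t_u)] < λ and E[l(ξ−t_l)] > λ; (ii) sup_{t∈T} E[l²(ξ−t)] < +∞; (iii) for any t ∈ T, ξ−t lies in the set of points where l is continuously differentiable with probability 1, there exists a random variable K(ξ) with E[K(ξ)²] < ∞ and |l(ξ−t₁)−l(ξ−t₂)| ≤ K(ξ)|t₁−t₂| for all t₁,t₂ ∈ T and almost every ξ, and Pr{l'(ξ−t*) > 0} > 0. Then √n(t_n − t*) converges in distribution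 to N(0, σ²) with σ² = Var[l(ξ−t*)] / (E[l'(ξ−t*)])² = (E[l²(ξ−t*)] − λ²) / (E[l'(ξ−t*)])². -/
open MeasureTheory ProbabilityTheory Filter Set

/-- Convergence in distribution to a law on `ℝ`, phrased via bounded continuous
test functions. -/
def TendstoInDistribution {Ω : Type*} [MeasurableSpace Ω] (P : Measure Ω)
    (X : ℕ → Ω → ℝ) (μ : Measure ℝ) : Prop :=
  ∀ f : ℝ → ℝ, Continuous f → (∃ C, ∀ x, |f x| ≤ C) →
    Tendsto (fun n => ∫ ω, f (X n ω) ∂P) atTop (nhds (∫ x, f x ∂μ))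

open Topology

/-- Chebyshev's inequality for the normalised sum of an i.i.d. sample. -/
lemma measureReal_le_abs_normalized_sum {Ω : Type*} [MeasurableSpace Ω] {P : Measure Ω}
    [IsProbabilityMeasure P] {Z : ℕ → Ω → ℝ} {Y : Ω → ℝ} (hY : MemLp Y 2 P)
    (hindep : iIndepFun Z P) (hident : ∀ i, IdentDistrib (Z i) Y P P) (n : ℕ) {c : ℝ}
    (hc : 0 < c) :
    P.real {ω | c ≤ |(√(n : ℝ))⁻¹ * (∑ j ∈ Finset.range n, Z j ω - n * ∫ ω, Y ω ∂P)|}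
      ≤ variance Y P / c ^ 2 := by
  have hZ : ∀ i, MemLp (Z i) 2 P := fun i => (hident i).memLp_iff.2 hY
  have hsum : MemLp (∑ j ∈ Finset.range n, Z j) 2 P := memLp_finsetSum' _ fun i _ => hZ i
  have hmem : MemLp (fun ω => (√(n : ℝ))⁻¹ * (∑ j ∈ Finset.range n, Z j) ω) 2 P :=
    hsum.const_mul _
  have hmean : ∫ ω, (√(n : ℝ))⁻¹ * (∑ j ∈ Finset.range n, Z j) ω ∂P
      = (√(n : ℝ))⁻¹ * (n * ∫ ω, Y ω ∂P) := by
    rw [integral_const_mul]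
    simp only [Finset.sum_apply]
    rw [integral_finsetSum _ fun i _ => (hZ i).integrable (by norm_num)]
    simp [fun i => (hident i).integral_eq]
  have hvar : variance (fun ω => (√(n : ℝ))⁻¹ * (∑ j ∈ Finset.range n, Z j) ω) P
      ≤ variance Y P := by
    rw [variance_const_mul, IndepFun.variance_sum (fun i _ => hZ i)
      (fun i _ j _ hij => hindep.indepFun hij)]
    simp only [fun i => (hident i).variance_eq, Finset.sum_const, Finset.card_range, nsmul_eq_mul,
      inv_pow, Real.sq_sqrt (Nat.cast_nonneg n)]
    rcases Nat.eq_zero_or_pos n with rfl | hn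
    · simp [variance_nonneg]
    · rw [inv_mul_cancel_left₀ (by positivity)]
  have h := meas_ge_le_variance_div_sq hmem hc
  rw [hmean] at h
  refine ENNReal.toReal_le_of_le_ofReal (by have := variance_nonneg Y P; positivity) ?_
  calc _ ≤ _ := by
        convert h using 5
        simp [mul_sub]
    _ ≤ _ := ENNReal.ofReal_le_ofReal (by gcongr)

/-- If `X n` is tight and the probability that a fixed level separates `X n` from `W n` by a
fixed margin vanishes, then `W n - X n` tends to zero in probability. -/
lemma tendstoInMeasure_sub_of_levels {Ω : Type*} [MeasurableSpace Ω] {P : Measure Ω}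
    [IsProbabilityMeasure P] {X W : ℕ → Ω → ℝ}
    (htight : ∀ δ > 0, ∃ M, ∀ n, P.real {ω | M ≤ |X n ω|} ≤ δ)
    (hup : ∀ s η : ℝ, 0 < η →
      Tendsto (fun n => P.real {ω | X n ω ≤ s - η ∧ s < W n ω}) atTop (𝓝 0))
    (hdown : ∀ s η : ℝ, 0 < η →
      Tendsto (fun n => P.real {ω | s + η ≤ X n ω ∧ W n ω < s}) atTop (𝓝 0)) :
    TendstoInMeasure P (W - X) atTop 0 := by
  rw [tendstoInMeasure_iff_measureReal_norm]
  intro ε hε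
  obtain ⟨η, hη, rfl⟩ : ∃ η : ℝ, 0 < η ∧ ε = 3 * η := ⟨ε / 3, by positivity, by ring⟩
  rw [Metric.tendsto_nhds]
  intro δ hδ
  obtain ⟨M, hM⟩ := htight (δ / 2) (by positivity)
  set N : ℤ := ⌈M / η⌉ + 3
  have hsum : Tendsto (fun n => ∑ k ∈ Finset.Icc (-N) N,
      (P.real {ω | X n ω ≤ k * η - η ∧ k * η < W n ω}
        + P.real {ω | k * η + η ≤ X n ω ∧ W n ω < k * η})) atTop (𝓝 0) := by
    simpa using tendsto_finsetSum (Finset.Icc (-N) N)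
      fun k _ => (hup (k * η) η hη).add (hdown (k * η) η hη)
  filter_upwards [hsum.eventually_lt_const (show (0 : ℝ) < δ / 2 by positivity)] with n hn
  rw [Real.dist_eq, sub_zero, abs_of_nonneg measureReal_nonneg]
  have hsub : {ω | 3 * η ≤ ‖(W - X) n ω - (0 : Ω → ℝ) ω‖} ⊆ {ω | M ≤ |X n ω|} ∪
      ⋃ k ∈ Finset.Icc (-N) N, ({ω | X n ω ≤ k * η - η ∧ k * η < W n ω} ∪
        {ω | k * η + η ≤ X n ω ∧ W n ω < k * η}) := by
    intro ω hω
    simp only [Pi.sub_apply, Pi.zero_apply, sub_zero, Real.norm_eq_abs, mem_ofPred_eq] at hω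
    by_cases hMω : M ≤ |X n ω|
    · exact Or.inl hMω
    right
    obtain ⟨h1, h2⟩ := abs_lt.1 (not_le.1 hMω)
    have hX : X n ω = X n ω / η * η := by field_simp
    have hb1 : -(M / η) < X n ω / η := by rw [← neg_div]; gcongr
    have hb2 : X n ω / η < M / η := by gcongr
    have hc := Int.le_ceil (M / η)
    simp only [mem_iUnion, Finset.mem_Icc]
    rcases le_abs.1 hω with h | h
    · have hf1 := Int.floor_le (X n ω / η)
      have hf2 := Int.lt_floor_add_one (X n ω / η)
      refine ⟨⌊X n ω / η⌋ + 2, ⟨?_, ?_⟩, Or.inl ⟨?_, ?_⟩⟩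
      · have : (-N : ℝ) < (⌊X n ω / η⌋ + 2 : ℝ) := by push_cast [N]; linarith
        exact_mod_cast this.le
      · have : (⌊X n ω / η⌋ + 2 : ℝ) < N := by push_cast [N]; linarith
        exact_mod_cast this.le
      · push_cast; nlinarith
      · push_cast; nlinarith
    · have hf1 := Int.le_ceil (X n ω / η)
      have hf2 := Int.ceil_lt_add_one (X n ω / η)
      refine ⟨⌈X n ω / η⌉ - 2, ⟨?_, ?_⟩, Or.inr ⟨?_, ?_⟩⟩
      · have : (-N : ℝ) < (⌈X n ω / η⌉ - 2 : ℝ) := by push_cast [N]; linarith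
        exact_mod_cast this.le
      · have : (⌈X n ω / η⌉ - 2 : ℝ) < N := by push_cast [N]; linarith
        exact_mod_cast this.le
      · push_cast; nlinarith
      · push_cast; nlinarith
  calc P.real {ω | 3 * η ≤ ‖(W - X) n ω - (0 : Ω → ℝ) ω‖}
      ≤ _ := measureReal_mono hsub
    _ ≤ P.real {ω | M ≤ |X n ω|} + ∑ k ∈ Finset.Icc (-N) N,
        (P.real {ω | X n ω ≤ k * η - η ∧ k * η < W n ω}
          + P.real {ω | k * η + η ≤ X n ω ∧ W n ω < k * η}) := by
        refine (measureReal_union_le _ _).trans ?_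
        gcongr
        refine (measureReal_biUnion_finset_le _ _).trans ?_
        gcongr
        exact measureReal_union_le _ _
    _ < δ := by linarith [hM n]

/-- The infimum of the feasible set of an antitone continuous constraint on `[a, b]` depends
measurably on the parameter. -/
lemma measurable_sInf_antitone_le {Ω : Type*} [MeasurableSpace Ω] {φ : Ω → ℝ → ℝ}
    {a b lam : ℝ} (hab : a ≤ b) (hmeas : ∀ t, Measurable fun ω => φ ω t)
    (hanti : ∀ ω, Antitone (φ ω)) (hcont : ∀ ω, Continuous (φ ω)) :
    Measurable fun ω => sInf {t ∈ Icc a b | φ ω t ≤ lam} := by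
  have hbdd : ∀ ω, BddBelow {t ∈ Icc a b | φ ω t ≤ lam} := fun ω => ⟨a, fun t ht => ht.1.1⟩
  have hle : ∀ t, MeasurableSet {ω | φ ω t ≤ lam} := fun t =>
    measurableSet_le (hmeas t) measurable_const
  refine measurable_of_Iic fun c => ?_
  have hset : (fun ω => sInf {t ∈ Icc a b | φ ω t ≤ lam}) ⁻¹' Iic c =
      ({ω | φ ω b ≤ lam} ∩ ({ω | b ≤ c} ∪ ({ω | a ≤ c} ∩ {ω | φ ω c ≤ lam}))) ∪
        ({ω | φ ω b ≤ lam}ᶜ ∩ {ω | 0 ≤ c}) := by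
    ext ω
    simp only [mem_preimage, mem_Iic, mem_union, mem_inter_iff, mem_ofPred_eq, mem_compl_iff]
    by_cases hb : φ ω b ≤ lam
    · have hmem : sInf {t ∈ Icc a b | φ ω t ≤ lam} ∈ {t ∈ Icc a b | φ ω t ≤ lam} :=
        (isClosed_Icc.inter (isClosed_le (hcont ω) continuous_const)).csInf_mem
          ⟨b, right_mem_Icc.2 hab, hb⟩ (hbdd ω)
      simp only [hb, true_and, not_true_eq_false, false_and, or_false]
      refine ⟨fun h => Or.inr ⟨hmem.1.1.trans h, (hanti ω h).trans hmem.2⟩, ?_⟩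
      rintro (h | ⟨h1, h2⟩)
      · exact hmem.1.2.trans h
      · rcases le_total c b with hcb | hbc
        · exact csInf_le (hbdd ω) ⟨⟨h1, hcb⟩, h2⟩
        · exact hmem.1.2.trans hbc
    · have hempty : {t ∈ Icc a b | φ ω t ≤ lam} = ∅ := by
        refine eq_empty_of_forall_notMem fun t ht => hb ((hanti ω ht.1.2).trans ht.2)
      rw [hempty]
      simp [hb]
  rw [hset]
  exact ((hle b).inter ((MeasurableSet.const _).union
    ((MeasurableSet.const _).inter (hle c)))).union ((hle b).compl.inter (MeasurableSet.const _))

/-- An antitone continuous constraint is active at the infimum of its feasible set in `[a, b]`,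
provided this infimum is not the left endpoint. -/
lemma eq_of_sInf_of_continuousOn {g : ℝ → ℝ} {a b lam t₀ : ℝ} (hg : ContinuousOn g (Icc a b))
    (hne : ∃ t ∈ Icc a b, g t ≤ lam) (ht₀ : t₀ = sInf {t ∈ Icc a b | g t ≤ lam})
    (hmem : t₀ ∈ Ioo a b) : g t₀ = lam := by
  have hbdd : BddBelow {t ∈ Icc a b | g t ≤ lam} := ⟨a, fun t ht => ht.1.1⟩
  have hclosed : IsClosed {t ∈ Icc a b | g t ≤ lam} :=
    hg.preimage_isClosed_of_isClosed isClosed_Icc isClosed_Iic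
  have hfeas : t₀ ∈ {t ∈ Icc a b | g t ≤ lam} := ht₀ ▸ hclosed.csInf_mem hne hbdd
  refine le_antisymm hfeas.2 (not_lt.1 fun hlt => ?_)
  have hev : ∀ᶠ t in 𝓝[<] t₀, g t < lam ∧ t ∈ Ioo a b ∧ t < t₀ := by
    have h1 := (hg.continuousAt (Icc_mem_nhds hmem.1 hmem.2)).eventually_lt_const hlt
    have h2 : ∀ᶠ t in 𝓝 t₀, t ∈ Ioo a b := Ioo_mem_nhds hmem.1 hmem.2
    exact (h1.filter_mono nhdsWithin_le_nhds).and
      ((h2.filter_mono nhdsWithin_le_nhds).and self_mem_nhdsWithin)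
  obtain ⟨t, h1, h2, h3⟩ := hev.exists
  exact absurd (csInf_le hbdd ⟨Ioo_subset_Icc_self h2, h1.le⟩) (not_le.2 (ht₀ ▸ h3))

/-- The infimum of the feasible set of an antitone constraint on `[a, b]` is bounded below by any
infeasible point, provided the constraint is feasible at `b`. -/
lemma le_sInf_of_antitone {φ : ℝ → ℝ} {a b lam u : ℝ} (hab : a ≤ b) (hφ : Antitone φ)
    (hb : φ b ≤ lam) (hu : lam < φ u) : u ≤ sInf {t ∈ Icc a b | φ t ≤ lam} := by
  refine le_csInf ⟨b, right_mem_Icc.2 hab, hb⟩ fun t ht => ?_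
  by_contra! h
  exact absurd (hφ h.le) (not_le.2 (ht.2.trans_lt hu))

lemma le_one_add_sq (x : ℝ) : x ≤ 1 + x ^ 2 := by nlinarith [sq_nonneg (x - 1)]

section ExpectedLoss

variable {Ω : Type*} [MeasurableSpace Ω] {P : Measure Ω}
  {l : ℝ → ℝ} {a b : ℝ} {ξ K : Ω → ℝ}

/-- The expected loss is continuous if the loss has a square-integrable Lipschitz modulus. -/
lemma continuousOn_expected_loss [IsProbabilityMeasure P]
    (hint : ∀ t ∈ Icc a b, Integrable (fun ω => l (ξ ω - t)) P)
    (hK : Integrable (fun ω => (K ω) ^ 2) P)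
    (hLip : ∀ᵐ ω ∂P, ∀ t₁ ∈ Icc a b, ∀ t₂ ∈ Icc a b,
      |l (ξ ω - t₁) - l (ξ ω - t₂)| ≤ K ω * |t₁ - t₂|) :
    ContinuousOn (fun t => ∫ ω, l (ξ ω - t) ∂P) (Icc a b) := by
  refine LipschitzOnWith.continuousOn (K := Real.toNNReal (∫ ω, (1 + K ω ^ 2) ∂P))
    (LipschitzOnWith.of_dist_le_mul fun t₁ h₁ t₂ h₂ => ?_)
  rw [Real.coe_toNNReal _ (integral_nonneg fun ω => by positivity), Real.dist_eq, Real.dist_eq,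
    ← integral_sub (hint _ h₁) (hint _ h₂), ← integral_mul_const, ← Real.norm_eq_abs]
  refine norm_integral_le_of_norm_le (((integrable_const _).add hK).mul_const _) ?_
  filter_upwards [hLip] with ω hω
  refine (hω t₁ h₁ t₂ h₂).trans ?_
  gcongr
  exact le_one_add_sq _

/-- Differentiation of the expected loss under the integral sign. -/
lemma hasDerivAt_expected_loss [IsProbabilityMeasure P] (hl : Continuous l)
    (hξ : Measurable ξ)
    (hint : ∀ t ∈ Icc a b, Integrable (fun ω => l (ξ ω - t)) P)
    (hK : Integrable (fun ω => (K ω) ^ 2) P)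
    (hLip : ∀ᵐ ω ∂P, ∀ t₁ ∈ Icc a b, ∀ t₂ ∈ Icc a b,
      |l (ξ ω - t₁) - l (ξ ω - t₂)| ≤ K ω * |t₁ - t₂|)
    {t₀ : ℝ} (ht₀ : t₀ ∈ Ioo a b) (hdiff : ∀ᵐ ω ∂P, DifferentiableAt ℝ l (ξ ω - t₀)) :
    Integrable (fun ω => deriv l (ξ ω - t₀)) P ∧
      HasDerivAt (fun t => ∫ ω, l (ξ ω - t) ∂P) (-∫ ω, deriv l (ξ ω - t₀) ∂P) t₀ := by
  have hd : Measurable fun ω => deriv l (ξ ω - t₀) :=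
    (measurable_deriv l).comp (hξ.sub_const t₀)
  have h := hasDerivAt_integral_of_dominated_loc_of_lip (μ := P) (𝕜 := ℝ)
    (F := fun t ω => l (ξ ω - t)) (F' := fun ω => -deriv l (ξ ω - t₀)) (x₀ := t₀)
    (s := Icc a b) (bound := fun ω => 1 + K ω ^ 2) (Icc_mem_nhds ht₀.1 ht₀.2)
    (Eventually.of_forall fun t => (hl.measurable.comp (hξ.sub_const t)).aestronglyMeasurable)
    (hint t₀ (Ioo_subset_Icc_self ht₀)) hd.neg.aestronglyMeasurable
    (by
      filter_upwards [hLip] with ω hω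
      refine LipschitzOnWith.of_dist_le_mul fun t₁ h₁ t₂ h₂ => ?_
      rw [Real.coe_nnabs, abs_of_nonneg (by positivity), Real.dist_eq, Real.dist_eq]
      refine (hω t₁ h₁ t₂ h₂).trans ?_
      gcongr
      exact le_one_add_sq _)
    ((integrable_const _).add hK)
    (by
      filter_upwards [hdiff] with ω hω
      simpa [Function.comp_def] using hω.hasDerivAt.comp t₀ ((hasDerivAt_id t₀).const_sub (ξ ω)))
  refine ⟨by simpa using h.1.neg, ?_⟩
  simpa [integral_neg] using h.2

/-- The expected derivative of a monotone loss is positive if the derivative is positive with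
positive probability. -/
lemma integral_deriv_pos_of_monotone (hl : Monotone l) {t₀ : ℝ}
    (hint : Integrable (fun ω => deriv l (ξ ω - t₀)) P)
    (hpos : 0 < P {ω | 0 < deriv l (ξ ω - t₀)}) : 0 < ∫ ω, deriv l (ξ ω - t₀) ∂P := by
  rw [integral_pos_iff_support_of_nonneg (fun ω => hl.deriv_nonneg) hint]
  exact hpos.trans_le (measure_mono fun ω hω => ne_of_gt hω)

/-- The variance of an increment of the loss is controlled by the Lipschitz modulus. -/
lemma variance_loss_increment_le [IsProbabilityMeasure P] (hl : Continuous l)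
    (hξ : Measurable ξ)
    (hK : Integrable (fun ω => (K ω) ^ 2) P)
    (hLip : ∀ᵐ ω ∂P, ∀ t₁ ∈ Icc a b, ∀ t₂ ∈ Icc a b,
      |l (ξ ω - t₁) - l (ξ ω - t₂)| ≤ K ω * |t₁ - t₂|)
    {t₁ t₂ : ℝ} (h₁ : t₁ ∈ Icc a b) (h₂ : t₂ ∈ Icc a b) :
    variance (fun ω => l (ξ ω - t₁) - l (ξ ω - t₂)) P
      ≤ (∫ ω, K ω ^ 2 ∂P) * (t₁ - t₂) ^ 2 := by
  have hmeas : Measurable fun ω => l (ξ ω - t₁) - l (ξ ω - t₂) :=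
    (hl.measurable.comp (hξ.sub_const t₁)).sub (hl.measurable.comp (hξ.sub_const t₂))
  refine (variance_le_expectation_sq hmeas.aestronglyMeasurable).trans ?_
  rw [← integral_mul_const]
  refine integral_mono_of_nonneg (ae_of_all _ fun ω => sq_nonneg _) (hK.mul_const _) ?_
  filter_upwards [hLip] with ω hω
  have := pow_le_pow_left₀ (abs_nonneg _) (hω t₁ h₁ t₂ h₂) 2
  simpa [mul_pow] using this

end ExpectedLoss

/-- Convergence in distribution in the sense of Mathlib implies convergence of the expectations
of bounded continuous functions. -/
lemma tendsto_integral_of_tendstoInDistribution {Ω Ω' : Type*} [MeasurableSpace Ω]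
    [MeasurableSpace Ω'] {P : Measure Ω} [IsProbabilityMeasure P] {P' : Measure Ω'}
    [IsProbabilityMeasure P'] {X : ℕ → Ω → ℝ} {Y : Ω' → ℝ} {μ : Measure ℝ}
    (h : MeasureTheory.TendstoInDistribution X atTop Y (fun _ => P) P') (hY : HasLaw Y μ P') :
    _root_.TendstoInDistribution P X μ := by
  rintro f hf ⟨C, hC⟩
  have := ProbabilityMeasure.tendsto_iff_forall_integral_tendsto.1 h.tendsto
    (BoundedContinuousFunction.ofNormedAddCommGroup f hf C hC)
  simpa [hY.map_eq, integral_map (h.forall_aemeasurable _) hf.aestronglyMeasurable] using this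

lemma tendsto_add_div_sqrt (t₀ s : ℝ) :
    Tendsto (fun n : ℕ => t₀ + s / √(n : ℝ)) atTop (𝓝 t₀) := by
  simpa using tendsto_const_nhds.add (tendsto_const_nhds.div_atTop
    (Real.tendsto_sqrt_atTop.comp tendsto_natCast_atTop_atTop) : Tendsto
      (fun n : ℕ => s / √(n : ℝ)) atTop (𝓝 0))

/-- First-order expansion along the perturbation `t₀ + s / √n`. -/
lemma tendsto_sqrt_mul_sub_of_hasDerivAt {g : ℝ → ℝ} {g' t₀ : ℝ} (hg : HasDerivAt g g' t₀)
    (s : ℝ) :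
    Tendsto (fun n : ℕ => √(n : ℝ) * (g (t₀ + s / √(n : ℝ)) - g t₀)) atTop (𝓝 (g' * s)) := by
  have hlim : Tendsto (fun n : ℕ => s / √(n : ℝ)) atTop (𝓝 0) := by
    simpa using (tendsto_add_div_sqrt t₀ s).sub_const t₀
  have hcomp : HasDerivAt (fun h => g (t₀ + h * s)) (g' * s) 0 := by
    have h1 : HasDerivAt (fun h : ℝ => t₀ + h * s) s 0 := by
      simpa using ((hasDerivAt_id (0 : ℝ)).mul_const s).const_add t₀
    have h2 : HasDerivAt g g' (t₀ + 0 * s) := by simpa using hg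
    exact h2.comp 0 h1
  have hinv : Tendsto (fun n : ℕ => (√(n : ℝ))⁻¹) atTop (𝓝[≠] 0) := by
    refine tendsto_nhdsWithin_iff.2 ⟨tendsto_inv_atTop_zero.comp
      (Real.tendsto_sqrt_atTop.comp tendsto_natCast_atTop_atTop), ?_⟩
    filter_upwards [eventually_gt_atTop 0] with n hn
    have : 0 < √(n : ℝ) := Real.sqrt_pos.2 (by exact_mod_cast hn)
    exact inv_ne_zero this.ne'
  refine (hcomp.tendsto_slope_zero.comp hinv).congr fun n => ?_
  simp [div_eq_inv_mul]

/-- Central limit theorem for an i.i.d. sample, rescaled by a constant. -/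
lemma tendstoInDistribution_normalized_sum_div {Ω : Type*} [MeasurableSpace Ω] {P : Measure Ω}
    [IsProbabilityMeasure P] {Z : ℕ → Ω → ℝ} {Y : Ω → ℝ} (hY : MemLp Y 2 P)
    (hindep : iIndepFun Z P) (hident : ∀ i, IdentDistrib (Z i) Y P P) {μ : ℝ}
    (hμ : ∫ ω, Y ω ∂P = μ) (m : ℝ) :
    MeasureTheory.TendstoInDistribution
      (fun (n : ℕ) ω => (√(n : ℝ))⁻¹ * (∑ j ∈ Finset.range n, Z j ω - n * μ) / m) atTop
      (fun x : ℝ => x / m) (fun _ => P) (gaussianReal 0 (variance Y P).toNNReal) := by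
  have hlaw : HasLaw (id : ℝ → ℝ) (gaussianReal 0 (variance (Z 0) P).toNNReal)
      (gaussianReal 0 (variance Y P).toNNReal) :=
    ⟨aemeasurable_id, by rw [Measure.map_id, (hident 0).variance_eq]⟩
  have h := tendstoInDistribution_inv_sqrt_mul_sum_sub hlaw ((hident 0).memLp_iff.2 hY) hindep
    fun i => (hident i).trans (hident 0).symm
  rw [(hident 0).integral_eq, hμ] at h
  exact h.continuous_comp (g := fun x => x / m) (by fun_prop)

lemma hasLaw_div_gaussianReal {v : ℝ} (hv : 0 ≤ v) (m : ℝ) :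
    HasLaw (fun x : ℝ => x / m) (gaussianReal 0 (v / m ^ 2).toNNReal)
      (gaussianReal 0 v.toNNReal) := by
  have hvar : (v / m ^ 2).toNNReal = v.toNNReal / .mk (m ^ 2) (sq_nonneg _) := by
    ext
    simp [hv, div_nonneg, sq_nonneg]
  rw [hvar]
  simpa using gaussianReal_div_const (HasLaw.id (μ := gaussianReal 0 v.toNNReal)) m

section SampleAverage

variable {Ω : Type*} [MeasurableSpace Ω] {P : Measure Ω} [IsProbabilityMeasure P]
  {l : ℝ → ℝ} {a b : ℝ} {ξ K : Ω → ℝ} {ξs : ℕ → Ω → ℝ}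

/-- The centred and normalised increments of the sample average between `t₀` and `t₀ + s / √n`
vanish in probability. -/
lemma tendsto_measureReal_centered_increment (hl : Continuous l) (hξ : Measurable ξ)
    (hindep : iIndepFun ξs P) (hident : ∀ i, IdentDistrib (ξs i) ξ P P)
    (hmem : ∀ t ∈ Icc a b, MemLp (fun ω => l (ξ ω - t)) 2 P)
    (hK : Integrable (fun ω => (K ω) ^ 2) P)
    (hLip : ∀ᵐ ω ∂P, ∀ t₁ ∈ Icc a b, ∀ t₂ ∈ Icc a b,
      |l (ξ ω - t₁) - l (ξ ω - t₂)| ≤ K ω * |t₁ - t₂|)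
    {t₀ : ℝ} (ht₀ : t₀ ∈ Ioo a b) (s : ℝ) {c : ℝ} (hc : 0 < c) :
    Tendsto (fun n : ℕ => P.real {ω | c ≤ |(√(n : ℝ))⁻¹ *
      (∑ j ∈ Finset.range n, (l (ξs j ω - (t₀ + s / √(n : ℝ))) - l (ξs j ω - t₀)) -
        n * ∫ ω, (l (ξ ω - (t₀ + s / √(n : ℝ))) - l (ξ ω - t₀)) ∂P)|}) atTop (𝓝 0) := by
  have hlim : Tendsto (fun n : ℕ => (∫ ω, K ω ^ 2 ∂P) * (t₀ + s / √(n : ℝ) - t₀) ^ 2 / c ^ 2)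
      atTop (𝓝 0) := by
    simpa using ((((tendsto_add_div_sqrt t₀ s).sub_const t₀).pow 2).const_mul
      (∫ ω, K ω ^ 2 ∂P)).div_const (c ^ 2)
  refine tendsto_of_tendsto_of_tendsto_of_le_of_le' tendsto_const_nhds hlim
    (Eventually.of_forall fun n => measureReal_nonneg) ?_
  filter_upwards [(tendsto_add_div_sqrt t₀ s).eventually (Icc_mem_nhds ht₀.1 ht₀.2)] with n hn
  have hu : Measurable fun x : ℝ => l (x - (t₀ + s / √(n : ℝ))) - l (x - t₀) := by
    have := hl.measurable
    fun_prop
  have h₀ := Ioo_subset_Icc_self ht₀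
  refine (measureReal_le_abs_normalized_sum ((hmem _ hn).sub (hmem _ h₀))
    (hindep.comp (fun _ (x : ℝ) => l (x - (t₀ + s / √(n : ℝ))) - l (x - t₀)) fun _ => hu)
    (fun i => (hident i).comp hu) n hc).trans ?_
  gcongr
  exact variance_loss_increment_le hl hξ hK hLip hn h₀

/-- The sample constraint is satisfied, with probability tending to one, wherever the true
constraint is strictly satisfied. -/
lemma tendsto_measureReal_lt_sample_average (hl : Continuous l)
    (hindep : iIndepFun ξs P) (hident : ∀ i, IdentDistrib (ξs i) ξ P P) {t lam : ℝ}
    (hmem : MemLp (fun ω => l (ξ ω - t)) 2 P) (hlt : ∫ ω, l (ξ ω - t) ∂P < lam) :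
    Tendsto (fun n : ℕ => P.real {ω | lam < (∑ j ∈ Finset.range n, l (ξs j ω - t)) / n})
      atTop (𝓝 0) := by
  set d := lam - ∫ ω, l (ξ ω - t) ∂P with hd
  have hdpos : 0 < d := sub_pos.2 hlt
  have hlim : Tendsto (fun n : ℕ => variance (fun ω => l (ξ ω - t)) P / (√(n : ℝ) * d) ^ 2)
      atTop (𝓝 0) := by
    refine tendsto_const_nhds.div_atTop ?_
    exact (tendsto_pow_atTop two_ne_zero).comp
      ((Real.tendsto_sqrt_atTop.comp tendsto_natCast_atTop_atTop).atTop_mul_const hdpos)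
  refine tendsto_of_tendsto_of_tendsto_of_le_of_le' tendsto_const_nhds hlim
    (Eventually.of_forall fun n => measureReal_nonneg) ?_
  filter_upwards [eventually_gt_atTop 0] with n hn
  have hn' : (0 : ℝ) < n := by exact_mod_cast hn
  have hsq : 0 < √(n : ℝ) := Real.sqrt_pos.2 hn'
  have hu : Measurable fun x : ℝ => l (x - t) := by
    have := hl.measurable
    fun_prop
  have hindep' : iIndepFun (fun i ω => l (ξs i ω - t)) P :=
    hindep.comp (fun _ x => l (x - t)) fun _ => hu
  refine le_trans (measureReal_mono fun ω hω => ?_) (measureReal_le_abs_normalized_sum hmem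
    hindep' (fun i => (hident i).comp hu) n (mul_pos hsq hdpos))
  have hω' : lam < (∑ j ∈ Finset.range n, l (ξs j ω - t)) / n := hω
  rw [lt_div_iff₀ hn'] at hω'
  change √(n : ℝ) * d ≤
    |(√(n : ℝ))⁻¹ * (∑ j ∈ Finset.range n, l (ξs j ω - t) - n * ∫ ω, l (ξ ω - t) ∂P)|
  refine le_trans ?_ (le_abs_self _)
  rw [le_inv_mul_iff₀ hsq, ← mul_assoc, Real.mul_self_sqrt hn'.le, hd]
  linarith

end SampleAverage

/-- CLT for the SAA estimator of the utility-based shortfall risk: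
`√n (t_n - t*) ⇒ N(0, σ²)` with
`σ² = Var[l(ξ - t*)] / (E[l'(ξ - t*)])² = (E[l²(ξ - t*)] - λ²) / (E[l'(ξ - t*)])²`. -/
theorem shortfall_risk_saa_clt
    {Ω : Type*} [MeasurableSpace Ω] (P : Measure Ω) [IsProbabilityMeasure P]
    (l : ℝ → ℝ) (hl_conv : ConvexOn ℝ Set.univ l) (hl_mono : Monotone l)
    (hl_cont : Continuous l)
    (lam : ℝ)
    -- the compact interval `T = [a, b]`
    (a b : ℝ) (hab : a ≤ b)
    -- the random loss and the i.i.d. sample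
    (ξ : Ω → ℝ) (hξ : Measurable ξ)
    (ξs : ℕ → Ω → ℝ) (hξs : ∀ i, Measurable (ξs i))
    (hiid : iIndepFun ξs P)
    (hident : ∀ i, IdentDistrib (ξs i) ξ P P)
    -- (i) there are `t_l, t_u` with `E[l(ξ - t_u)] < λ` and `E[l(ξ - t_l)] > λ`
    (tl tu : ℝ) (htl : tl ∈ Icc a b) (htu : tu ∈ Icc a b)
    (hint1 : ∀ t ∈ Icc a b, Integrable (fun ω => l (ξ ω - t)) P)
    (hslater_u : ∫ ω, l (ξ ω - tu) ∂P < lam)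
    (hslater_l : ∫ ω, l (ξ ω - tl) ∂P > lam)
    -- (ii) `sup_{t ∈ T} E[l²(ξ - t)] < +∞`
    (hint2 : ∀ t ∈ Icc a b, Integrable (fun ω => (l (ξ ω - t)) ^ 2) P)
    (hbdd : BddAbove ((fun t => ∫ ω, (l (ξ ω - t)) ^ 2 ∂P) '' Icc a b))
    -- the SR `t*`: optimal value of `min {t ∈ T : E[l(ξ - t)] ≤ λ}`, interior to `T`
    (tstar : ℝ)
    (htstar : tstar = sInf {t ∈ Icc a b | ∫ ω, l (ξ ω - t) ∂P ≤ lam})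
    (htstar_int : tstar ∈ Ioo a b)
    -- (iii) `ξ - t ∈ D_l` w.p.1, Lipschitz with square-integrable modulus, and
    -- `Pr{l'(ξ - t*) > 0} > 0`
    (hDl : ∀ t ∈ Icc a b, ∀ᵐ ω ∂P, ContDiffAt ℝ 1 l (ξ ω - t))
    (K : Ω → ℝ) (hK2 : Integrable (fun ω => (K ω) ^ 2) P)
    (hLip : ∀ᵐ ω ∂P, ∀ t₁ ∈ Icc a b, ∀ t₂ ∈ Icc a b,
      |l (ξ ω - t₁) - l (ξ ω - t₂)| ≤ K ω * |t₁ - t₂|)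
    (hpos : 0 < P {ω | 0 < deriv l (ξ ω - tstar)})
    -- the SAA estimator: optimal value of the sample problem
    (tn : ℕ → Ω → ℝ)
    (htn : ∀ n ω, tn n ω =
      sInf {t ∈ Icc a b | (∑ j ∈ Finset.range n, l (ξs j ω - t)) / n ≤ lam}) :
    TendstoInDistribution P (fun n ω => Real.sqrt n * (tn n ω - tstar))
      (gaussianReal 0
        ((variance (fun ω => l (ξ ω - tstar)) P /
          (∫ ω, deriv l (ξ ω - tstar) ∂P) ^ 2)).toNNReal) ∧
    variance (fun ω => l (ξ ω - tstar)) P /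
        (∫ ω, deriv l (ξ ω - tstar) ∂P) ^ 2 =
      ((∫ ω, (l (ξ ω - tstar)) ^ 2 ∂P) - lam ^ 2) /
        (∫ ω, deriv l (ξ ω - tstar) ∂P) ^ 2 := by

  have hmeasl := hl_cont.measurable
  have hstar := Ioo_subset_Icc_self htstar_int
  have hmem : ∀ t ∈ Icc a b, MemLp (fun ω => l (ξ ω - t)) 2 P := fun t ht =>
    (memLp_two_iff_integrable_sq (hint1 t ht).aestronglyMeasurable).2 (hint2 t ht)
  set g : ℝ → ℝ := fun t => ∫ ω, l (ξ ω - t) ∂P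
  have hgstar : g tstar = lam := eq_of_sInf_of_continuousOn
    (continuousOn_expected_loss hint1 hK2 hLip) ⟨tu, htu, hslater_u.le⟩ htstar htstar_int
  obtain ⟨hderiv_int, hderiv⟩ := hasDerivAt_expected_loss hl_cont hξ hint1 hK2 hLip htstar_int
    ((hDl tstar hstar).mono fun ω hω => hω.differentiableAt one_ne_zero)
  have hmpos := integral_deriv_pos_of_monotone hl_mono hderiv_int hpos
  set m := ∫ ω, deriv l (ξ ω - tstar) ∂P
  refine ⟨?_, by rw [variance_eq_sub (hmem _ hstar)]; simp only [Pi.pow_apply]; rw [← hgstar]⟩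
  set φ : ℕ → Ω → ℝ → ℝ := fun n ω t => (∑ j ∈ Finset.range n, l (ξs j ω - t)) / n with hφ
  have hφ_anti : ∀ n ω, Antitone (φ n ω) := fun n ω t₁ t₂ h => by
    simp only [hφ]
    gcongr
    exact hl_mono (by linarith)
  have htn_meas : ∀ n, Measurable (tn n) := fun n => by
    rw [show tn n = fun ω => sInf {t ∈ Icc a b | φ n ω t ≤ lam} from funext (htn n)]
    refine measurable_sInf_antitone_le hab (fun t => ?_) (hφ_anti n) (fun ω => ?_)
    · simp only [hφ]
      fun_prop
    · simp only [hφ]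
      fun_prop
  have hu : Measurable fun x : ℝ => l (x - tstar) := by fun_prop
  have hindep : iIndepFun (fun i ω => l (ξs i ω - tstar)) P :=
    hiid.comp (fun _ (x : ℝ) => l (x - tstar)) fun _ => hu
  have hid : ∀ i, IdentDistrib (fun ω => l (ξs i ω - tstar)) (fun ω => l (ξ ω - tstar)) P P :=
    fun i => (hident i).comp hu
  set v := variance (fun ω => l (ξ ω - tstar)) P
  set X : ℕ → Ω → ℝ := fun n ω =>
    (√(n : ℝ))⁻¹ * (∑ j ∈ Finset.range n, l (ξs j ω - tstar) - n * lam) / m with hX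
  have hclt : MeasureTheory.TendstoInDistribution X atTop (fun x : ℝ => x / m) (fun _ => P)
      (gaussianReal 0 v.toNNReal) :=
    tendstoInDistribution_normalized_sum_div (hmem _ hstar) hindep hid hgstar m
  refine tendsto_integral_of_tendstoInDistribution
    (tendstoInDistribution_of_tendstoInMeasure_sub _ _ hclt ?_
      fun n => (((htn_meas n).sub_const _).const_mul _).aemeasurable)
    (hasLaw_div_gaussianReal (variance_nonneg _ _) m)
  -- the rescaled sample constraint at `t* + s / √n`
  set B : ℝ → ℕ → Ω → ℝ := fun s n ω => (√(n : ℝ))⁻¹ *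
    (∑ j ∈ Finset.range n, (l (ξs j ω - (tstar + s / √(n : ℝ))) - l (ξs j ω - tstar)) -
      n * ∫ ω, (l (ξ ω - (tstar + s / √(n : ℝ))) - l (ξ ω - tstar)) ∂P) with hB
  have hBlim : ∀ s c : ℝ, 0 < c → Tendsto (fun n => P.real {ω | c ≤ |B s n ω|}) atTop (𝓝 0) :=
    fun s c hc => tendsto_measureReal_centered_increment hl_cont hξ hiid hident hmem hK2 hLip
      htstar_int s hc
  have hexpand : ∀ s c : ℝ, 0 < c → ∀ᶠ n : ℕ in atTop, 0 < √(n : ℝ) ∧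
      tstar + s / √(n : ℝ) ∈ Icc a b ∧ ∀ ω,
        |√(n : ℝ) * (φ n ω (tstar + s / √(n : ℝ)) - lam) - (m * (X n ω - s) + B s n ω)| < c := by
    intro s c hc
    have hlim := Metric.tendsto_nhds.1 (tendsto_sqrt_mul_sub_of_hasDerivAt hderiv s) c hc
    filter_upwards [hlim, eventually_gt_atTop 0,
      (tendsto_add_div_sqrt tstar s).eventually (Icc_mem_nhds htstar_int.1 htstar_int.2)]
      with n hn hn0 hnmem
    have hn' : (0 : ℝ) < n := by exact_mod_cast hn0
    have hsq : 0 < √(n : ℝ) := Real.sqrt_pos.2 hn'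
    refine ⟨hsq, hnmem, fun ω => ?_⟩
    rw [Real.dist_eq] at hn
    convert hn using 2
    change _ = √(n : ℝ) * (g _ - g tstar) - -m * s
    have hsub : ∫ ω, (l (ξ ω - (tstar + s / √(n : ℝ))) - l (ξ ω - tstar)) ∂P
        = g (tstar + s / √(n : ℝ)) - lam := by
      rw [integral_sub (hint1 _ hnmem) (hint1 _ hstar), ← hgstar]
    have hnn : (n : ℝ) = √(n : ℝ) * √(n : ℝ) := (Real.mul_self_sqrt hn'.le).symm
    simp only [hφ, hX, hB, hsub, hgstar, Finset.sum_sub_distrib]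
    generalize g (tstar + s / √(n : ℝ)) = G
    generalize (∑ j ∈ Finset.range n, l (ξs j ω - (tstar + s / √(n : ℝ)))) = S₁
    generalize (∑ j ∈ Finset.range n, l (ξs j ω - tstar)) = S₂
    rw [hnn]
    simp only [Real.sqrt_mul_self hsq.le]
    field_simp
    ring
  refine tendstoInMeasure_sub_of_levels (fun δ hδ => ?_) (fun s η hη => ?_) (fun s η hη => ?_)
  · have hvnn : 0 ≤ v := variance_nonneg _ _
    refine ⟨√((v + 1) / δ) / m, fun n => ?_⟩
    have hc : 0 < √((v + 1) / δ) := Real.sqrt_pos.2 (by positivity)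
    have h := measureReal_le_abs_normalized_sum (hmem _ hstar) hindep hid n hc
    rw [show (∫ ω, l (ξ ω - tstar) ∂P) = lam from hgstar, Real.sq_sqrt (by positivity)] at h
    calc _ = _ := by
          congr 1
          ext ω
          simp only [hX, mem_ofPred_eq, abs_div, abs_of_pos hmpos, div_le_div_iff_of_pos_right hmpos]
      _ ≤ v / ((v + 1) / δ) := h
      _ ≤ δ := by
          rw [div_div_eq_mul_div, div_le_iff₀ (by positivity)]
          nlinarith
  · refine tendsto_of_tendsto_of_tendsto_of_le_of_le' tendsto_const_nhds
      (hBlim s (m * η / 2) (by positivity)) (Eventually.of_forall fun n => measureReal_nonneg) ?_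
    filter_upwards [hexpand s (m * η / 2) (by positivity)] with n ⟨hsq, hnmem, hn⟩
    refine measureReal_mono fun ω ⟨h1, h2⟩ => ?_
    have hlt : lam < φ n ω (tstar + s / √(n : ℝ)) := by
      by_contra! h
      have hle : tn n ω ≤ tstar + s / √(n : ℝ) := by
        rw [htn n ω]
        exact csInf_le ⟨a, fun t ht => ht.1.1⟩ ⟨hnmem, h⟩
      rw [← sub_le_iff_le_add', le_div_iff₀ hsq] at hle
      linarith
    have h3 := (abs_lt.1 (hn ω)).2
    have h4 : 0 < √(n : ℝ) * (φ n ω (tstar + s / √(n : ℝ)) - lam) :=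
      mul_pos hsq (sub_pos.2 hlt)
    have h5 : m * (X n ω - s) ≤ m * (-η) := by gcongr; linarith
    have h6 : m * η / 2 ≤ B s n ω := by linarith
    exact h6.trans (le_abs_self _)
  · have hgb : g b < lam := by
      refine lt_of_le_of_lt (integral_mono (hint1 b (right_mem_Icc.2 hab)) (hint1 tu htu)
        fun ω => hl_mono ?_) hslater_u
      linarith [htu.2]
    have hb := tendsto_measureReal_lt_sample_average hl_cont hiid hident
      (hmem b (right_mem_Icc.2 hab)) hgb
    refine tendsto_of_tendsto_of_tendsto_of_le_of_le' tendsto_const_nhds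
      (by simpa using hb.add (hBlim s (m * η / 2) (by positivity)))
      (Eventually.of_forall fun n => measureReal_nonneg) ?_
    filter_upwards [hexpand s (m * η / 2) (by positivity)] with n ⟨hsq, hnmem, hn⟩
    refine le_trans (measureReal_mono ?_) (measureReal_union_le _ _)
    rintro ω ⟨h1, h2⟩
    by_cases hfeas : φ n ω b ≤ lam
    · right
      have hle : φ n ω (tstar + s / √(n : ℝ)) ≤ lam := by
        by_contra! h
        have hle := le_sInf_of_antitone hab (hφ_anti n ω) hfeas h
        rw [← htn n ω, ← le_sub_iff_add_le', div_le_iff₀ hsq] at hle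
        linarith
      have h3 := (abs_lt.1 (hn ω)).1
      have h4 : √(n : ℝ) * (φ n ω (tstar + s / √(n : ℝ)) - lam) ≤ 0 :=
        mul_nonpos_of_nonneg_of_nonpos hsq.le (sub_nonpos.2 hle)
      have h5 : m * η ≤ m * (X n ω - s) := by gcongr; linarith
      have h6 : m * η / 2 ≤ -B s n ω := by linarith
      exact h6.trans (neg_le_abs _)
    · exact Or.inl (not_le.1 hfeas)
end
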